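/- arXiv:2411.06760 — 2 statements merged into one kernel-verified Lean document; each statement's English description precedes it below -/
import Mathlib

section
/- Chen's identity (splitting form): Let γ : [0,1] → ℝⁿ be a continuously differentiable path and let s ∈ [0,1]. For every k ≥ 1 and all indices i₁,…,i_k ∈ {1,…,n}, S^{[0,1]}_{i₁⋯i_k}(γ) = ∑_{j=0}^{k} S^{[0,s]}_{i₁⋯i_j}(γ) · S^{[s,1]}_{i_{j+1}⋯i_k}(γ), where the empty coefficient (j = 0 or j = k) is taken to be 1. -/
open MeasureTheory

/-- The signature coefficient `S^{[a,b]}_{i₁⋯i_m}(γ)` of a path `γ : ℝ → ℝⁿ`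
over the subinterval `[a,b]`: the iterated integral over the simplex
`a < u₁ < ⋯ < u_m < b` of the product of coordinate derivatives.  For the empty
index list (`m = 0`) it equals `1`. -/
noncomputable def sigCoeffOn {n : ℕ} (γ : ℝ → (Fin n → ℝ)) (a b : ℝ) {m : ℕ}
    (idx : Fin m → Fin n) : ℝ :=
  ∫ u in {u : Fin m → ℝ | StrictMono u ∧ ∀ i, u i ∈ Set.Ioo a b},
    ∏ i, deriv (fun t => γ t (idx i)) (u i)

/-- Concatenation of finite real tuples preserves Lebesgue measure. -/
theorem measurePreserving_fin_append (j m : ℕ) :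
    MeasurePreserving
      (fun p : (Fin j → ℝ) × (Fin m → ℝ) => (Fin.append p.1 p.2 : Fin (j + m) → ℝ)) := by
  have h := (volume_measurePreserving_piCongrLeft (fun _ : Fin (j + m) => ℝ)
    finSumFinEquiv).comp
      (volume_measurePreserving_sumPiEquivProdPi_symm (fun _ : Fin j ⊕ Fin m => ℝ))
  convert! h using 1
  funext p i
  obtain ⟨x, rfl⟩ := (finSumFinEquiv (m := j) (n := m)).surjective i
  simp only [Function.comp_apply, MeasurableEquiv.coe_piCongrLeft]
  rw [Equiv.piCongrLeft_apply_apply]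
  cases x <;> simp [MeasurableEquiv.sumPiEquivProdPi, Equiv.sumPiEquivProdPi]

theorem measurableEmbedding_fin_append (j m : ℕ) :
    MeasurableEmbedding
      (fun p : (Fin j → ℝ) × (Fin m → ℝ) => (Fin.append p.1 p.2 : Fin (j + m) → ℝ)) := by
  refine (measurePreserving_fin_append j m).measurable.measurableEmbedding ?_
  intro p q h
  have h' : ∀ i, Fin.append p.1 p.2 i = Fin.append q.1 q.2 i := fun i => congrFun h i
  refine Prod.ext (funext fun i => ?_) (funext fun i => ?_)
  · simpa using h' (Fin.castAdd m i)
  · simpa using h' (Fin.natAdd j i)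

/-- The integral of a product of one-variable functions over a product region factors. -/
theorem setIntegral_prod_fin_append {j m : ℕ} (f : Fin (j + m) → ℝ → ℝ)
    (A : Set (Fin (j + m) → ℝ)) (S : Set (Fin j → ℝ)) (T : Set (Fin m → ℝ))
    (hA : ∀ x y, Fin.append x y ∈ A ↔ x ∈ S ∧ y ∈ T) :
    ∫ u in A, ∏ i, f i (u i) =
      (∫ x in S, ∏ i, f (Fin.castAdd m i) (x i)) *
        ∫ y in T, ∏ i, f (Fin.natAdd j i) (y i) := by
  rw [← (measurePreserving_fin_append j m).setIntegral_preimage_emb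
    (measurableEmbedding_fin_append j m), ← setIntegral_prod_mul, ← Measure.volume_eq_prod]
  have hpre : (fun p : (Fin j → ℝ) × (Fin m → ℝ) =>
      (Fin.append p.1 p.2 : Fin (j + m) → ℝ)) ⁻¹' A = S ×ˢ T := by
    ext p
    exact hA p.1 p.2
  rw [hpre]
  simp [Fin.prod_univ_add]

/-- Increasing tuples in `(a, b)`. -/
def openSimplex (a b : ℝ) (k : ℕ) : Set (Fin k → ℝ) :=
  {u | StrictMono u ∧ ∀ i, u i ∈ Set.Ioo a b}

/-- Increasing tuples whose first `j` entries lie in `(a, s)` and whose other entries lie in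
`(s, b)`. -/
def splitSimplex (a s b : ℝ) (k j : ℕ) : Set (Fin k → ℝ) :=
  {u | StrictMono u ∧ ∀ i : Fin k,
    (i.val < j → u i ∈ Set.Ioo a s) ∧ (j ≤ i.val → u i ∈ Set.Ioo s b)}

theorem fin_append_mem_splitSimplex {a s b : ℝ} {j m : ℕ} (x : Fin j → ℝ) (y : Fin m → ℝ) :
    (Fin.append x y : Fin (j + m) → ℝ) ∈ splitSimplex a s b (j + m) j ↔
      x ∈ openSimplex a s j ∧ y ∈ openSimplex s b m := by
  constructor
  · rintro ⟨hmono, h⟩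
    refine ⟨⟨fun p q hpq => ?_, fun i => ?_⟩, ⟨fun p q hpq => ?_, fun i => ?_⟩⟩
    · have := hmono (Fin.strictMono_castAdd m hpq)
      simpa using this
    · simpa using (h (Fin.castAdd m i)).1 (by simp)
    · have := hmono (Fin.strictMono_natAdd j hpq)
      simpa using this
    · simpa using (h (Fin.natAdd j i)).2 (by simp)
  · rintro ⟨⟨hx, hx'⟩, ⟨hy, hy'⟩⟩
    refine ⟨fun p q hpq => ?_, fun i => ?_⟩
    · induction p using Fin.addCases with
      | left p =>
        induction q using Fin.addCases with
        | left q => simpa using hx ((Fin.strictMono_castAdd m).lt_iff_lt.mp hpq)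
        | right q => simpa using (hx' p).2.trans (hy' q).1
      | right p =>
        induction q using Fin.addCases with
        | left q =>
          have := q.isLt
          simp only [Fin.lt_def, Fin.val_natAdd, Fin.val_castAdd] at hpq
          omega
        | right q => simpa using hy ((Fin.strictMono_natAdd j).lt_iff_lt.mp hpq)
    · induction i using Fin.addCases with
      | left i => simpa using hx' i
      | right i => simpa using hy' i

theorem measurableSet_splitSimplex (a s b : ℝ) (k j : ℕ) :
    MeasurableSet (splitSimplex a s b k j) := by
  have h : splitSimplex a s b k j =
      (⋂ p : Fin k, ⋂ q : Fin k, ⋂ _ : p < q, {u : Fin k → ℝ | u p < u q}) ∩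
      ((⋂ i : Fin k, ⋂ _ : i.val < j, {u : Fin k → ℝ | u i ∈ Set.Ioo a s}) ∩
        ⋂ i : Fin k, ⋂ _ : j ≤ i.val, {u : Fin k → ℝ | u i ∈ Set.Ioo s b}) := by
    ext u
    simp only [splitSimplex, StrictMono, Set.mem_ofPred_eq, Set.mem_inter_iff, Set.mem_iInter,
      forall_and]
  rw [h]
  refine .inter (.iInter fun p => .iInter fun q => .iInter fun _ => ?_)
    (.inter (.iInter fun i => .iInter fun _ => ?_) (.iInter fun i => .iInter fun _ => ?_))
  · exact measurableSet_lt (measurable_pi_apply p) (measurable_pi_apply q)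
  · exact measurable_pi_apply i measurableSet_Ioo
  · exact measurable_pi_apply i measurableSet_Ioo

theorem splitSimplex_subset_openSimplex {a s b : ℝ} (has : a ≤ s) (hsb : s ≤ b) (k j : ℕ) :
    splitSimplex a s b k j ⊆ openSimplex a b k := by
  rintro u ⟨hmono, h⟩
  refine ⟨hmono, fun i => ?_⟩
  rcases lt_or_ge i.val j with hi | hi
  · exact ⟨((h i).1 hi).1, ((h i).1 hi).2.trans_le hsb⟩
  · exact ⟨has.trans_lt ((h i).2 hi).1, ((h i).2 hi).2⟩

theorem pairwise_disjoint_splitSimplex (a s b : ℝ) (k : ℕ) :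
    Pairwise (Function.onFun Disjoint fun j : Fin (k + 1) => splitSimplex a s b k j.val) := by
  have key : ∀ j l : Fin (k + 1), j < l →
      Disjoint (splitSimplex a s b k j.val) (splitSimplex a s b k l.val) := by
    intro j l hjl
    rw [Set.disjoint_left]
    intro u hu hu'
    have hlt : j.val < l.val := hjl
    let i : Fin k := ⟨j.val, by omega⟩
    exact lt_asymm ((hu.2 i).2 le_rfl).1 ((hu'.2 i).1 hlt).2
  intro j l hjl
  rcases lt_or_gt_of_ne hjl with h | h
  · exact key j l h
  · exact (key l j h).symm

theorem exists_mem_splitSimplex {a s b : ℝ} {k : ℕ} {u : Fin k → ℝ}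
    (hu : u ∈ openSimplex a b k) (hne : ∀ i, u i ≠ s) :
    ∃ j : Fin (k + 1), u ∈ splitSimplex a s b k j.val := by
  classical
  have hex : ∃ j : ℕ, ∀ i : Fin k, j ≤ i.val → s < u i :=
    ⟨k, fun i hi => absurd i.isLt (not_lt.mpr hi)⟩
  have hle : Nat.find hex ≤ k := Nat.find_min' hex fun i hi => absurd i.isLt (not_lt.mpr hi)
  refine ⟨⟨Nat.find hex, Nat.lt_succ_of_le hle⟩, hu.1, fun i => ⟨fun hi => ?_, fun hi => ?_⟩⟩
  · refine ⟨(hu.2 i).1, ?_⟩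
    have hmin := Nat.find_min hex (m := i.val) hi
    push Not at hmin
    obtain ⟨l, hil, hl⟩ := hmin
    exact lt_of_le_of_ne ((hu.1.monotone (Fin.le_def.mpr hil)).trans hl) (hne i)
  · exact ⟨Nat.find_spec hex i hi, (hu.2 i).2⟩

/-- Up to a null set, the simplex over `(a, b)` is the union of its splittings at `s`. -/
theorem openSimplex_ae_eq_iUnion_splitSimplex {a s b : ℝ} (has : a ≤ s) (hsb : s ≤ b) (k : ℕ) :
    openSimplex a b k =ᵐ[volume] ⋃ j : Fin (k + 1), splitSimplex a s b k j.val := by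
  have hne : ∀ᵐ u : Fin k → ℝ, ∀ i, u i ≠ s := by
    rw [ae_all_iff]
    intro i
    have h : volume {u : Fin k → ℝ | u i = s} = 0 :=
      Measure.pi_hyperplane (fun _ : Fin k => (volume : Measure ℝ)) i s
    rw [ae_iff]
    simpa using h
  rw [Filter.eventuallyEq_set]
  filter_upwards [hne] with u hu
  rw [Set.mem_iUnion]
  exact ⟨fun h => exists_mem_splitSimplex h hu,
    fun ⟨j, hj⟩ => splitSimplex_subset_openSimplex has hsb k j.val hj⟩

theorem integrableOn_prod_openSimplex {a b : ℝ} {k : ℕ} {f : Fin k → ℝ → ℝ}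
    (hf : ∀ i, IntegrableOn (f i) (Set.Ioo a b)) :
    IntegrableOn (fun u : Fin k → ℝ => ∏ i, f i (u i)) (openSimplex a b k) := by
  have h : IntegrableOn (fun u : Fin k → ℝ => ∏ i, f i (u i))
      (Set.univ.pi fun _ => Set.Ioo a b) := by
    rw [IntegrableOn, volume_pi, Measure.restrict_pi_pi]
    exact Integrable.fintype_prod hf
  exact h.mono_set fun u hu i _ => hu.2 i

theorem setIntegral_splitSimplex {a s b : ℝ} {k j : ℕ} (hj : j ≤ k) (f : Fin k → ℝ → ℝ) :
    ∫ u in splitSimplex a s b k j, ∏ i, f i (u i) =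
      (∫ x in openSimplex a s j, ∏ i, f (Fin.castLE hj i) (x i)) *
        ∫ y in openSimplex s b (k - j),
          ∏ i : Fin (k - j), f ⟨j + i.val, by omega⟩ (y i) := by
  obtain ⟨m, rfl⟩ := Nat.exists_eq_add_of_le hj
  have hm : j + m - j = m := Nat.add_sub_cancel_left ..
  rw [setIntegral_prod_fin_append f _ _ _ fin_append_mem_splitSimplex]
  congr 1
  have key : ∀ (l : ℕ) (hl : l = m),
      ∫ y in openSimplex s b m, ∏ i, f (Fin.natAdd j i) (y i) =
        ∫ y in openSimplex s b l, ∏ i : Fin l, f ⟨j + i.val, by omega⟩ (y i) := by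
    rintro l rfl
    rfl
  exact key _ hm

/-- Chen's splitting identity for iterated integrals of integrable functions. -/
theorem setIntegral_openSimplex_eq_sum {a s b : ℝ} (has : a ≤ s) (hsb : s ≤ b) {k : ℕ}
    {f : Fin k → ℝ → ℝ} (hf : ∀ i, IntegrableOn (f i) (Set.Ioo a b)) :
    ∫ u in openSimplex a b k, ∏ i, f i (u i) =
      ∑ j : Fin (k + 1),
        (∫ x in openSimplex a s j.val,
          ∏ i, f (Fin.castLE (Nat.lt_succ_iff.mp j.isLt) i) (x i)) *
        ∫ y in openSimplex s b (k - j.val),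
          ∏ i : Fin (k - j.val), f ⟨j.val + i.val, by omega⟩ (y i) := by
  rw [setIntegral_congr_set (openSimplex_ae_eq_iUnion_splitSimplex has hsb k),
    integral_iUnion_fintype (s := fun j : Fin (k + 1) => splitSimplex a s b k j.val)
      (fun j => measurableSet_splitSimplex a s b k j.val)
      (pairwise_disjoint_splitSimplex a s b k)
      (fun j => (integrableOn_prod_openSimplex hf).mono_set
        (splitSimplex_subset_openSimplex has hsb k j.val))]
  exact Finset.sum_congr rfl fun j _ => setIntegral_splitSimplex _ f

theorem ContDiffOn.integrableOn_deriv_Ioo {g : ℝ → ℝ} {a b : ℝ} (hab : a < b)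
    (hg : ContDiffOn ℝ 1 g (Set.Icc a b)) : IntegrableOn (deriv g) (Set.Ioo a b) := by
  have hc : ContinuousOn (derivWithin g (Set.Icc a b)) (Set.Icc a b) :=
    hg.continuousOn_derivWithin (uniqueDiffOn_Icc hab) le_rfl
  refine (hc.integrableOn_Icc.mono_set Set.Ioo_subset_Icc_self).congr_fun (fun t ht => ?_)
    measurableSet_Ioo
  exact derivWithin_of_mem_nhds (Icc_mem_nhds ht.1 ht.2)

/-- Chen's identity, splitting form: the signature coefficient of `γ` over
`[0,1]` with indices `i₁,…,i_k` equals
`∑_{j=0}^{k} S^{[0,s]}_{i₁⋯i_j}(γ) · S^{[s,1]}_{i_{j+1}⋯i_k}(γ)`. -/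
theorem chen_identity {n : ℕ} (γ : ℝ → (Fin n → ℝ))
    (hγ : ContDiffOn ℝ 1 γ (Set.Icc 0 1))
    (s : ℝ) (hs : s ∈ Set.Icc (0:ℝ) 1)
    {k : ℕ} (hk : 1 ≤ k) (idx : Fin k → Fin n) :
    sigCoeffOn γ 0 1 idx =
      ∑ j : Fin (k+1),
        sigCoeffOn γ 0 s
            (fun i : Fin j.val => idx (Fin.castLE (Nat.lt_succ_iff.mp j.isLt) i)) *
          sigCoeffOn γ s 1
            (fun i : Fin (k - j.val) =>
              idx ⟨j.val + i.val, by have := i.isLt; have := j.isLt; omega⟩) := by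
  have hf : ∀ i, IntegrableOn (deriv fun t => γ t (idx i)) (Set.Ioo 0 1) := fun i =>
    ContDiffOn.integrableOn_deriv_Ioo one_pos (contDiffOn_pi.mp hγ (idx i))
  exact setIntegral_openSimplex_eq_sum hs.1 hs.2 hf
end

section
/- Let (λ₁,λ₂,λ₃) ∈ ℝ³ be nonzero, set r = √(λ₁²+λ₂²+λ₃²), and let M be the 3×3 real matrix M = 2·[[0, −λ₃, λ₂], [λ₃, 0, −λ₁], [−λ₂, λ₁, 0]]. Then the matrix power series ∑_{k=0}^{∞} ((−1)^k/(k+1)!) M^k converges, and its determinant equals sin²(r)/r². (This is the Jacobian of the exponential map of SU(2) at the Lie algebra element λ₁e₁+λ₂e₂+λ₃e₃, where M = ad_{λ₁e₁+λ₂e₂+λ₃e₃} in the standard basis of su(2).) -/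
open Real

lemma pow_two_mul_add_one_of_pow_three_eq {A : Type*} [Ring A] [Algebra ℝ A] {x : A} {t : ℝ}
    (hx : x ^ 3 = (-t ^ 2) • x) (m : ℕ) : x ^ (2 * m + 1) = (-t ^ 2) ^ m • x := by
  induction m with
  | zero => simp
  | succ m ih =>
    have h : x ^ (2 * (m + 1) + 1) = x ^ 2 * x ^ (2 * m + 1) := by rw [← pow_add]; ring_nf
    rw [h, ih, mul_smul_comm, ← pow_succ, hx, smul_smul, pow_succ (-t ^ 2) m]

/-- If `x ^ 3 = -t ^ 2 • x` with `t ≠ 0`, then the series `∑ (-1) ^ k / (k + 1)! • x ^ k`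
for `(1 - exp (-x)) / x` sums to `1 - (1 - cos t) / t ^ 2 • x + (t - sin t) / t ^ 3 • x ^ 2`. -/
lemma hasSum_neg_one_pow_div_factorial_succ_smul_pow {A : Type*} [Ring A] [Algebra ℝ A]
    [TopologicalSpace A] [ContinuousAdd A] [ContinuousSMul ℝ A] {x : A} {t : ℝ} (ht : t ≠ 0)
    (hx : x ^ 3 = (-t ^ 2) • x) :
    HasSum (fun k : ℕ => ((-1 : ℝ) ^ k / (Nat.factorial (k + 1) : ℝ)) • x ^ k)
      (1 - ((1 - cos t) / t ^ 2) • x + ((t - sin t) / t ^ 3) • x ^ 2) := by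
  have hsin := (Real.hasSum_sin t).mul_right (-(t ^ 3)⁻¹)
  have heven : HasSum
      (fun m : ℕ => ((-1 : ℝ) ^ (2 * m) / (Nat.factorial (2 * m + 1) : ℝ)) • x ^ (2 * m))
      ((sin t * -(t ^ 3)⁻¹) • x ^ 2 + (1 + (t ^ 2)⁻¹ • x ^ 2)) := by
    refine ((hsin.smul_const (x ^ 2)).add
      (hasSum_ite_eq 0 (1 + (t ^ 2)⁻¹ • x ^ 2))).congr_fun ?_
    intro m
    rcases m with _ | m
    · simp only [mul_zero, pow_zero, zero_add, if_true, Nat.factorial_one, Nat.cast_one, pow_one]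
      match_scalars <;> field_simp
      ring
    · have h : x ^ (2 * (m + 1)) = (-t ^ 2) ^ m • x ^ 2 := by
        rw [mul_add, mul_one, pow_succ, pow_two_mul_add_one_of_pow_three_eq hx, smul_mul_assoc, ← sq]
      rw [h, if_neg (Nat.succ_ne_zero m), add_zero, smul_smul, pow_mul, neg_one_sq, one_pow,
        neg_pow (t ^ 2)]
      congr 1
      field_simp
      ring
  have hcos := ((hasSum_nat_add_iff' 1).mpr (Real.hasSum_cos t)).mul_right ((t ^ 2)⁻¹)
  have hodd : HasSum
      (fun m : ℕ =>
        ((-1 : ℝ) ^ (2 * m + 1) / (Nat.factorial (2 * m + 1 + 1) : ℝ)) • x ^ (2 * m + 1))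
      (((cos t - 1) * (t ^ 2)⁻¹) • x) := by
    simp only [Finset.sum_range_one, mul_zero, pow_zero, Nat.factorial_zero, Nat.cast_one,
      div_one, mul_one] at hcos
    refine (hcos.smul_const x).congr_fun ?_
    intro m
    rw [pow_two_mul_add_one_of_pow_three_eq hx, smul_smul, pow_succ, pow_mul, neg_one_sq, one_pow,
      neg_pow (t ^ 2), mul_add 2 m 1, mul_one]
    congr 1
    field_simp
    ring
  have hsum := HasSum.even_add_odd
    (f := fun k : ℕ => ((-1 : ℝ) ^ k / (Nat.factorial (k + 1) : ℝ)) • x ^ k) heven hodd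
  convert hsum using 1
  match_scalars <;> field_simp <;> ring

/-- The Jacobian of the exponential map of `SU(2)`: for nonzero
`(λ₁,λ₂,λ₃) ∈ ℝ³` with `r = √(λ₁²+λ₂²+λ₃²)` and
`M = 2·[[0,−λ₃,λ₂],[λ₃,0,−λ₁],[−λ₂,λ₁,0]] = ad_{λ₁e₁+λ₂e₂+λ₃e₃}`, the power
series `∑_{k≥0} ((−1)^k/(k+1)!) M^k` converges (entrywise), and the determinant
of its sum equals `sin²(r)/r²`. -/
theorem jacobian_exp_su2 (l₁ l₂ l₃ : ℝ) (hne : ¬(l₁ = 0 ∧ l₂ = 0 ∧ l₃ = 0)) :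
    let r : ℝ := Real.sqrt (l₁ ^ 2 + l₂ ^ 2 + l₃ ^ 2)
    let M : Matrix (Fin 3) (Fin 3) ℝ :=
      (2 : ℝ) • Matrix.of ![![0, -l₃, l₂], ![l₃, 0, -l₁], ![-l₂, l₁, 0]]
    ∃ L : Matrix (Fin 3) (Fin 3) ℝ,
      (∀ i j, HasSum
          (fun k : ℕ => ((-1 : ℝ) ^ k / (Nat.factorial (k + 1) : ℝ)) * (M ^ k) i j)
          (L i j)) ∧
      L.det = Real.sin r ^ 2 / r ^ 2 := by
  intro r M
  have hr2 : r ^ 2 = l₁ ^ 2 + l₂ ^ 2 + l₃ ^ 2 := Real.sq_sqrt (by positivity)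
  have hr : r ≠ 0 := by
    intro h
    rw [h] at hr2
    exact hne ⟨by nlinarith, by nlinarith, by nlinarith⟩
  have hM : M ^ 3 = (-(2 * r) ^ 2) • M := by
    rw [mul_pow, hr2]
    ext i j
    fin_cases i <;> fin_cases j <;>
      simp [M, pow_succ, Matrix.mul_apply, Fin.sum_univ_three] <;> ring
  have hsum := hasSum_neg_one_pow_div_factorial_succ_smul_pow (mul_ne_zero two_ne_zero hr) hM
  refine ⟨_, fun i j => Pi.hasSum.mp (Pi.hasSum.mp hsum i) j, ?_⟩
  have hdet (a b : ℝ) : (1 - a • M + b • M ^ 2).det =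
      (1 - b * (2 * r) ^ 2) ^ 2 + a ^ 2 * (2 * r) ^ 2 := by
    rw [mul_pow, hr2]
    simp [M, Matrix.det_fin_three, sq]
    ring
  rw [hdet, cos_two_mul, sin_two_mul]
  field_simp
  have h := sin_sq_add_cos_sq r
  have hc : cos r ^ 2 = 1 - sin r ^ 2 := by linarith
  ring_nf
  simp only [show cos r ^ 4 = (cos r ^ 2) ^ 2 by ring, hc]
  ring
end
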